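/- arXiv:1609.01016 — 3 statements merged into one kernel-verified Lean document; each statement's English description precedes it below -/
import Mathlib

section
/- Let A be a set with 13 ≤ |A| ≤ ℵ₀ such that either |A| is an odd natural number, or |A| is even with |A| ≥ 58 (ℵ₀ regarded as even). Then the lattice Quo(A) contains a sublattice S (a subset closed under binary joins and binary meets of Quo(A), not required to be closed under infinite joins or meets) such that S contains all atoms of Quo(A) and S is generated, as a lattice under finite joins and meets, by a four-element set {x₁, x₂, x₃, x₄} with x₁ < x₂ such that both {x₁, x₃, x₄} and {x₂, x₃, x₄} are antichains. -/
universe u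

open Set

/-- The diagonal (equality) relation on `α`, as a set of pairs. -/
def diagRel (α : Type u) : Set (α × α) := {p | p.1 = p.2}

/-- A quasiorder (preorder): a reflexive and transitive binary relation, as a set of pairs. -/
def IsQuoRel {α : Type u} (r : Set (α × α)) : Prop :=
  (∀ a : α, (a, a) ∈ r) ∧ ∀ a b c : α, (a, b) ∈ r → (b, c) ∈ r → (a, c) ∈ r

/-- A transitive binary relation, as a set of pairs. -/
def IsTranRel {α : Type u} (r : Set (α × α)) : Prop :=
  ∀ a b c : α, (a, b) ∈ r → (b, c) ∈ r → (a, c) ∈ r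

/-- An equivalence relation, as a set of pairs. -/
def IsEquRel {α : Type u} (r : Set (α × α)) : Prop :=
  IsQuoRel r ∧ ∀ p : α × α, p ∈ r → (p.2, p.1) ∈ r

/-- `Quo(α)`: the set of all quasiorders on `α`. -/
def QuoRels (α : Type u) : Set (Set (α × α)) := {r | IsQuoRel r}

/-- `Tran(α)`: the set of all transitive relations on `α`. -/
def TranRels (α : Type u) : Set (Set (α × α)) := {r | IsTranRel r}

/-- `Equ(α)`: the set of all equivalence relations on `α`. -/
def EquRels (α : Type u) : Set (Set (α × α)) := {r | IsEquRel r}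

/-- The least quasiorder containing `r` (the reflexive-transitive closure of `r`). -/
def quoGen {α : Type u} (r : Set (α × α)) : Set (α × α) := ⋂₀ {s | IsQuoRel s ∧ r ⊆ s}

/-- The least transitive relation containing `r` (the transitive closure of `r`). -/
def tranGen {α : Type u} (r : Set (α × α)) : Set (α × α) := ⋂₀ {s | IsTranRel s ∧ r ⊆ s}

/-- The least equivalence relation containing `r`. -/
def equGen {α : Type u} (r : Set (α × α)) : Set (α × α) := ⋂₀ {s | IsEquRel s ∧ r ⊆ s}

/-- `quo(a,b)`: the least quasiorder containing the pair `(a,b)`. -/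
def quoPair {α : Type u} (a b : α) : Set (α × α) := quoGen {(a, b)}

/-- `equ(a,b)`: the least equivalence relation containing the pair `(a,b)`. -/
def equPair {α : Type u} (a b : α) : Set (α × α) := equGen {(a, b)}

/-- The involution: the inverse of a relation. -/
def invRel {α : Type u} (r : Set (α × α)) : Set (α × α) := {p | (p.2, p.1) ∈ r}

/-- `T` is closed under arbitrary (possibly infinite, possibly empty) joins and
meets of the complete lattice `Quo(α)`: the meet of a family of quasiorders is its
intersection and the join is the quasiorder generated by its union. -/
def QuoClosed {α : Type u} (T : Set (Set (α × α))) : Prop :=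
  (∀ S ⊆ T, quoGen (⋃₀ S) ∈ T) ∧ (∀ S ⊆ T, ⋂₀ S ∈ T)

/-- `X` generates the complete lattice `Quo(α)` in the complete sense. -/
def QuoGenerates {α : Type u} (X : Set (Set (α × α))) : Prop :=
  X ⊆ QuoRels α ∧ ∀ T ⊆ QuoRels α, X ⊆ T → QuoClosed T → T = QuoRels α

/-- `T` is closed under arbitrary joins and meets of the complete lattice `Tran(α)`. -/
def TranClosed {α : Type u} (T : Set (Set (α × α))) : Prop :=
  (∀ S ⊆ T, tranGen (⋃₀ S) ∈ T) ∧ (∀ S ⊆ T, ⋂₀ S ∈ T)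

/-- `X` generates the complete lattice `Tran(α)` in the complete sense. -/
def TranGenerates {α : Type u} (X : Set (Set (α × α))) : Prop :=
  X ⊆ TranRels α ∧ ∀ T ⊆ TranRels α, X ⊆ T → TranClosed T → T = TranRels α

/-- `X` generates `Quo(α)` as a complete involution lattice. -/
def QuoInvGenerates {α : Type u} (X : Set (Set (α × α))) : Prop :=
  X ⊆ QuoRels α ∧ ∀ T ⊆ QuoRels α, X ⊆ T → QuoClosed T →
    (∀ r ∈ T, invRel r ∈ T) → T = QuoRels α

/-- `X` generates `Tran(α)` as a complete involution lattice. -/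
def TranInvGenerates {α : Type u} (X : Set (Set (α × α))) : Prop :=
  X ⊆ TranRels α ∧ ∀ T ⊆ TranRels α, X ⊆ T → TranClosed T →
    (∀ r ∈ T, invRel r ∈ T) → T = TranRels α

/-- Incomparability (with respect to inclusion). -/
def Incomp {α : Type u} (a b : Set (α × α)) : Prop := ¬ a ⊆ b ∧ ¬ b ⊆ a

/-- The complete lattice `Quo(α)` is `(1+1+2)`-generated: it is generated, in the
complete sense, by a four-element set `{x₁,x₂,x₃,x₄}` with `x₁ < x₂` such that both
`{x₁,x₃,x₄}` and `{x₂,x₃,x₄}` are antichains. -/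
def QuoOneOneTwoGenerated (α : Type u) : Prop :=
  ∃ x₁ x₂ x₃ x₄ : Set (α × α),
    x₁ ⊂ x₂ ∧ Incomp x₁ x₃ ∧ Incomp x₁ x₄ ∧ Incomp x₂ x₃ ∧ Incomp x₂ x₄ ∧
    Incomp x₃ x₄ ∧ QuoGenerates {x₁, x₂, x₃, x₄}

/-- A cardinal is accessible: it is finite, or it is infinite and every cardinal
`lam ≤ κ` satisfies `lam ≤ 2 ^ μ` for some `μ < lam`, or is at most a sum of fewer
than `lam` many cardinals each smaller than `lam`. -/
def AccessibleCard (κ : Cardinal.{u}) : Prop :=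
  κ < Cardinal.aleph0 ∨
    (Cardinal.aleph0 ≤ κ ∧ ∀ lam : Cardinal.{u}, lam ≤ κ →
      (∃ μ : Cardinal.{u}, μ < lam ∧ lam ≤ 2 ^ μ) ∨
      ∃ (ι : Type u) (f : ι → Cardinal.{u}),
        Cardinal.mk ι < lam ∧ (∀ i : ι, f i < lam) ∧ lam ≤ Cardinal.sum f)
/-- An atom of `Quo(α)`: a quasiorder covering the least element (the diagonal). -/
def QuoAtom {α : Type u} (r : Set (α × α)) : Prop :=
  IsQuoRel r ∧ r ≠ diagRel α ∧ ∀ s : Set (α × α), IsQuoRel s → s ⊆ r →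
    s = diagRel α ∨ s = r

/-- The quasiorder whose only nontrivial pair is `(a, b)`. -/
def singleRel {α : Type u} (a b : α) : Set (α × α) := {p | p.1 = p.2 ∨ p = (a, b)}

theorem quoGen_singleRel_union {α : Type u} {r : Set (α × α)} (hr : IsQuoRel r) (a b : α) :
    quoGen (singleRel a b ∪ r) = {p | p ∈ r ∨ ((p.1, a) ∈ r ∧ (b, p.2) ∈ r)} := by
  apply Subset.antisymm
  · apply sInter_subset_of_mem
    refine ⟨⟨fun c => Or.inl (hr.1 c), ?_⟩, ?_⟩
    · rintro c d e (h | ⟨h, h'⟩) (k | ⟨k, k'⟩)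
      · exact Or.inl (hr.2 _ _ _ h k)
      · exact Or.inr ⟨hr.2 _ _ _ h k, k'⟩
      · exact Or.inr ⟨h, hr.2 _ _ _ h' k⟩
      · exact Or.inr ⟨h, k'⟩
    · rintro ⟨c, d⟩ (h | h)
      · rcases h with h | h
        · obtain rfl : c = d := h
          exact Or.inl (hr.1 c)
        · obtain ⟨rfl, rfl⟩ := Prod.mk.inj h
          exact Or.inr ⟨hr.1 c, hr.1 d⟩
      · exact Or.inl h
  · rintro ⟨c, d⟩ h
    refine mem_sInter.2 fun s ⟨hs, hsub⟩ => ?_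
    rcases h with h | ⟨h, h'⟩
    · exact hsub (Or.inr h)
    · exact hs.2 _ _ _ (hs.2 _ _ _ (hsub (Or.inr h)) (hsub (Or.inl (Or.inr rfl))))
        (hsub (Or.inr h'))

theorem singleRel_isQuoRel {α : Type u} (a b : α) : IsQuoRel (singleRel a b) := by
  refine ⟨fun c => Or.inl rfl, fun c d e h k => ?_⟩
  rcases h with h | h
  · obtain rfl : c = d := h
    exact k
  · rcases k with k | k
    · obtain rfl : d = e := k
      exact Or.inr h
    · simp only [Prod.mk.injEq] at h k
      exact Or.inr (Prod.ext h.1 k.2)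

theorem QuoAtom.exists_eq_singleRel {α : Type u} {r : Set (α × α)} (h : QuoAtom r) :
    ∃ a b : α, a ≠ b ∧ r = singleRel a b := by
  obtain ⟨hr, hne, hmin⟩ := h
  have hdiag : diagRel α ⊆ r := by
    rintro ⟨a, b⟩ h
    obtain rfl : a = b := h
    exact hr.1 a
  obtain ⟨⟨a, b⟩, hab, hnd⟩ := not_subset.1 fun hsub => hne (hsub.antisymm hdiag)
  refine ⟨a, b, hnd, ?_⟩
  have hsub : singleRel a b ⊆ r := by
    rintro p (hp | rfl)
    · exact hdiag hp
    · exact hab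
  rcases hmin (singleRel a b) (singleRel_isQuoRel a b) hsub with h | h
  · exact absurd (h ▸ Or.inr rfl : (a, b) ∈ diagRel α) hnd
  · exact h.symm

/-- A set of quasiorders closed under binary joins and meets. -/
structure QuoSublattice {α : Type u} (T : Set (Set (α × α))) : Prop where
  isQuoRel : T ⊆ QuoRels α
  join : ∀ a ∈ T, ∀ b ∈ T, quoGen (a ∪ b) ∈ T
  meet : ∀ a ∈ T, ∀ b ∈ T, a ∩ b ∈ T

namespace QuoSublattice

variable {α : Type u} {T : Set (Set (α × α))} {r h : Set (α × α)}

theorem singleRel_mem_of_cut (hT : QuoSublattice T) {a b s t : α} (hab : singleRel a b ∈ T)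
    (hr : r ∈ T) (hh : h ∈ T) (hst : (s, t) ∈ h) (hsa : (s, a) ∈ r) (hbt : (b, t) ∈ r)
    (hcut : ∀ c d, (c, d) ∈ h → ((c, d) ∈ r ∨ ((c, a) ∈ r ∧ (b, d) ∈ r)) →
      c = d ∨ (c = s ∧ d = t)) : singleRel s t ∈ T := by
  have hmem := hT.meet _ (hT.join _ hab _ hr) _ hh
  rw [quoGen_singleRel_union (hT.isQuoRel hr)] at hmem
  convert hmem using 1
  ext ⟨c, d⟩
  constructor
  · rintro (h' | h')
    · obtain rfl : c = d := h'
      exact ⟨Or.inl ((hT.isQuoRel hr).1 c), (hT.isQuoRel hh).1 c⟩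
    · obtain ⟨rfl, rfl⟩ := Prod.mk.inj h'
      exact ⟨Or.inr ⟨hsa, hbt⟩, hst⟩
  · rintro ⟨h1, h2⟩
    rcases hcut c d h2 h1 with h' | ⟨rfl, rfl⟩
    · exact Or.inl h'
    · exact Or.inr rfl

theorem singleRel_mem_of_via (hT : QuoSublattice T) {a k b : α} (hab : a ≠ b)
    (hak : singleRel a k ∈ T) (hkb : singleRel k b ∈ T) (hh : h ∈ T) (h1 : (a, b) ∈ h)
    (h2 : (a, k) ∉ h) (h3 : (k, b) ∉ h) : singleRel a b ∈ T := by
  refine hT.singleRel_mem_of_cut hak hkb hh h1 (Or.inl rfl) (Or.inr rfl) fun c d hcd hor => ?_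
  simp only [singleRel, Set.mem_ofPred_eq, Prod.mk.injEq] at hor
  rcases hor with (h' | ⟨rfl, rfl⟩) | ⟨h' | ⟨-, h'⟩, h''⟩
  · exact Or.inl h'
  · exact absurd hcd h3
  · subst h'
    rcases h'' with rfl | ⟨-, rfl⟩
    · exact absurd hcd h2
    · exact Or.inr ⟨rfl, rfl⟩
  · exact absurd h' hab

theorem singleRel_mem_of_fork (hT : QuoSublattice T) {a k l b : α} (hab : a ≠ b) (hkl : k ≠ l)
    (hak' : a ≠ k) (hkb' : k ≠ b) (hak : singleRel a k ∈ T) (hkb : singleRel k b ∈ T)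
    (hal : singleRel a l ∈ T) (hlb : singleRel l b ∈ T) : singleRel a b ∈ T := by
  have hmem := hT.join _ hal _ hlb
  rw [quoGen_singleRel_union (singleRel_isQuoRel l b)] at hmem
  refine hT.singleRel_mem_of_via hab hak hkb hmem (Or.inr ⟨Or.inl rfl, Or.inr rfl⟩) ?_ ?_ <;>
  · simp only [singleRel, Set.mem_ofPred_eq, Prod.mk.injEq]
    grind

end QuoSublattice

/-- The class representative of `a` used by the `i`-th generator: elements below `8` represent
themselves, and every element from `8` on is glued to a representative. -/
def rep (i a : ℕ) : ℕ :=
  if a < 8 then a else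
    match i with
    | 0 => if a % 2 = 1 then 0 else a
    | 1 => if a % 2 = 1 then 0 else 1
    | 2 => if a % 2 = 1 then a else a - 1
    | _ => if a % 2 = 1 then a - 1 else a

/-- The nontrivial pairs of the four generators among the elements below `8`. -/
def baseTable : ℕ → List (ℕ × ℕ)
  | 0 => [(0, 3), (0, 7), (1, 2), (2, 1), (4, 6), (5, 1), (5, 2), (7, 0), (7, 3)]
  | 1 => [(0, 3), (0, 7), (1, 2), (1, 5), (2, 1), (2, 5), (3, 0), (3, 7), (4, 0), (4, 3), (4, 6),
          (4, 7), (5, 1), (5, 2), (7, 0), (7, 3)]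
  | 2 => [(0, 4), (2, 0), (2, 4), (2, 6), (3, 5), (6, 0), (6, 2), (6, 4)]
  | _ => [(1, 3), (1, 4), (3, 1), (3, 4), (4, 1), (4, 3), (5, 6), (5, 7), (6, 5), (6, 7), (7, 5),
          (7, 6)]

/-- The four generating quasiorders on `ℕ`. -/
def gen (i a b : ℕ) : Prop := rep i a = rep i b ∨ (rep i a, rep i b) ∈ baseTable i

instance (i a b : ℕ) : Decidable (gen i a b) := inferInstanceAs (Decidable (_ ∨ _))

theorem gen_refl (i a : ℕ) : gen i a a := Or.inl rfl

theorem baseTable_trans (i : ℕ) : ∀ p ∈ baseTable i, ∀ q ∈ baseTable i, p.2 = q.1 →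
    p.1 = q.2 ∨ (p.1, q.2) ∈ baseTable i := by
  match i with
  | 0 => decide +kernel
  | 1 => decide +kernel
  | 2 => decide +kernel
  | n + 3 => exact (by decide +kernel : ∀ p ∈ baseTable 3, ∀ q ∈ baseTable 3, p.2 = q.1 →
      p.1 = q.2 ∨ (p.1, q.2) ∈ baseTable 3)

theorem gen_trans {i a b c : ℕ} (hab : gen i a b) (hbc : gen i b c) : gen i a c := by
  rcases hab with h | h
  · unfold gen; rw [h]; exact hbc
  · rcases hbc with h' | h'
    · right; rwa [← h']
    · exact baseTable_trans i _ h _ h' rfl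

theorem lt_of_mem_baseTable (i : ℕ) : ∀ p ∈ baseTable i, p.1 < 8 ∧ p.2 < 8 := by
  match i with
  | 0 => decide +kernel
  | 1 => decide +kernel
  | 2 => decide +kernel
  | n + 3 => exact (by decide +kernel : ∀ p ∈ baseTable 3, p.1 < 8 ∧ p.2 < 8)

theorem gen_iff_of_le_left {i a b : ℕ} (h : 8 ≤ rep i a) : gen i a b ↔ rep i a = rep i b :=
  or_iff_left fun hm => (lt_of_mem_baseTable i _ hm).1.not_ge h

theorem gen_iff_of_le_right {i a b : ℕ} (h : 8 ≤ rep i b) : gen i a b ↔ rep i a = rep i b :=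
  or_iff_left fun hm => (lt_of_mem_baseTable i _ hm).2.not_ge h

theorem gen_two_iff_of_left {a b : ℕ} (ha : 9 ≤ a) :
    gen 2 a b ↔ b = a ∨ (a % 2 = 1 ∧ b = a + 1) ∨ (a % 2 = 0 ∧ b + 1 = a) := by
  rw [gen_iff_of_le_left (by simp only [rep]; split_ifs <;> omega)]
  simp only [rep]
  split_ifs <;> omega

theorem gen_two_iff_of_right {a b : ℕ} (hb : 9 ≤ b) :
    gen 2 a b ↔ a = b ∨ (b % 2 = 1 ∧ a = b + 1) ∨ (b % 2 = 0 ∧ a + 1 = b) := by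
  rw [gen_iff_of_le_right (by simp only [rep]; split_ifs <;> omega)]
  simp only [rep]
  split_ifs <;> omega

theorem gen_three_iff_of_left {i a b : ℕ} (ha : 8 ≤ a) :
    gen (i + 3) a b ↔ b = a ∨ (a % 2 = 0 ∧ b = a + 1) ∨ (a % 2 = 1 ∧ b + 1 = a) := by
  rw [gen_iff_of_le_left (by simp only [rep]; split_ifs <;> omega)]
  simp only [rep]
  split_ifs <;> omega

theorem gen_three_iff_of_right {i a b : ℕ} (hb : 8 ≤ b) :
    gen (i + 3) a b ↔ a = b ∨ (b % 2 = 0 ∧ a = b + 1) ∨ (b % 2 = 1 ∧ a + 1 = b) := by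
  rw [gen_iff_of_le_right (by simp only [rep]; split_ifs <;> omega)]
  simp only [rep]
  split_ifs <;> omega

theorem gen_one_of_gen_zero {a b : ℕ} (h : gen 0 a b) : gen 1 a b := by
  rcases h with h | h
  · left
    simp only [rep] at h ⊢
    split_ifs at h ⊢ <;> omega
  · right
    have rep_eq : ∀ c, rep 0 c < 8 → rep 1 c = rep 0 c := fun c hc => by
      simp only [rep] at hc ⊢
      split_ifs at hc ⊢ <;> omega
    have hlt := lt_of_mem_baseTable 0 _ h
    rw [rep_eq a hlt.1, rep_eq b hlt.2]
    exact (by decide +kernel : ∀ p ∈ baseTable 0, p ∈ baseTable 1) _ h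

/-- Beyond `8`, whether `a` is below an element of the core depends on the parity of `a` only. -/
theorem gen_left_of_parity {i a a' u : ℕ} (ha : 9 ≤ a) (ha' : 9 ≤ a') (hp : a % 2 = a' % 2)
    (hu : u < 8) (h : gen i a u) : gen i a' u := by
  match i with
  | 0 =>
    rcases Nat.mod_two_eq_zero_or_one a with h2 | h2
    · rw [gen_iff_of_le_left (by simp only [rep]; split_ifs <;> omega)] at h
      simp only [rep] at h
      split_ifs at h <;> omega
    · have : rep 0 a' = rep 0 a := by simp only [rep]; split_ifs <;> omega
      rwa [gen, this]
  | 1 =>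
    have : rep 1 a' = rep 1 a := by simp only [rep]; split_ifs <;> omega
    rwa [gen, this]
  | 2 => rw [gen_two_iff_of_left ha] at h; omega
  | n + 3 => rw [gen_three_iff_of_left (by omega)] at h; omega

theorem gen_right_of_parity {i b b' v : ℕ} (hb : 9 ≤ b) (hb' : 9 ≤ b') (hp : b % 2 = b' % 2)
    (hv : v < 8) (h : gen i v b) : gen i v b' := by
  match i with
  | 0 =>
    rcases Nat.mod_two_eq_zero_or_one b with h2 | h2
    · rw [gen_iff_of_le_right (by simp only [rep]; split_ifs <;> omega)] at h
      simp only [rep] at h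
      split_ifs at h <;> omega
    · have : rep 0 b' = rep 0 b := by simp only [rep]; split_ifs <;> omega
      rwa [gen, this]
  | 1 =>
    have : rep 1 b' = rep 1 b := by simp only [rep]; split_ifs <;> omega
    rwa [gen, this]
  | 2 => rw [gen_two_iff_of_right hb] at h; omega
  | n + 3 => rw [gen_three_iff_of_right (by omega)] at h; omega

/-- Two generators other than the comparable ones `gen 0` and `gen 1` meet trivially beyond the
core. -/
theorem eq_of_gen_of_gen {g h a b : ℕ} (hg : 2 ≤ g) (hne : h < g) (hg4 : g < 4)
    (hab : 10 ≤ a ∨ 10 ≤ b) (h1 : gen g a b) (h2 : gen h a b) : a = b := by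
  have hcons : 9 ≤ a ∧ 9 ≤ b ∧ (b = a ∨ b = a + 1 ∨ b + 1 = a) := by
    obtain rfl | rfl : g = 2 ∨ g = 0 + 3 := by omega
    · rcases hab with h | h
      · rw [gen_two_iff_of_left (by omega)] at h1; omega
      · rw [gen_two_iff_of_right (by omega)] at h1; omega
    · rcases hab with h | h
      · rw [gen_three_iff_of_left (by omega)] at h1; omega
      · rw [gen_three_iff_of_right (by omega)] at h1; omega
  obtain ⟨ha, hb, hc⟩ := hcons
  obtain rfl | rfl | rfl : h = 0 ∨ h = 1 ∨ h = 2 := by omega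
  · by_contra hne
    rcases Nat.mod_two_eq_zero_or_one a with h3 | h3
    · rw [gen_iff_of_le_left (by simp only [rep]; split_ifs <;> omega)] at h2
      simp only [rep] at h2
      split_ifs at h2 <;> omega
    · rw [gen_iff_of_le_right (by simp only [rep]; split_ifs <;> omega)] at h2
      simp only [rep] at h2
      split_ifs at h2 <;> omega
  · rcases h2 with h2 | h2
    · simp only [rep] at h2
      split_ifs at h2 <;> omega
    · exfalso
      have key : (rep 1 a = 0 ∧ rep 1 b = 1) ∨ (rep 1 a = 1 ∧ rep 1 b = 0) ∨
          rep 1 a = rep 1 b := by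
        simp only [rep]; split_ifs <;> omega
      have hnot : (0, 1) ∉ baseTable 1 ∧ (1, 0) ∉ baseTable 1 ∧ ∀ p ∈ baseTable 1, p.1 ≠ p.2 := by
        decide +kernel
      rcases key with ⟨k1, k2⟩ | ⟨k1, k2⟩ | k
      · rw [k1, k2] at h2; exact hnot.1 h2
      · rw [k1, k2] at h2; exact hnot.2.1 h2
      · exact hnot.2.2 _ h2 k
  · obtain rfl : g = 0 + 3 := by omega
    rw [gen_two_iff_of_left ha] at h2
    rw [gen_three_iff_of_left (by omega)] at h1
    omega

theorem exists_small_of_gen {g h a b u v : ℕ} (hgh : 2 ≤ g ∨ 2 ≤ h) (hab : 13 ≤ a ∨ 13 ≤ b)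
    (hne : a ≠ b) (hu : u < 8) (hv : v < 8) (h1 : gen h a b) (h2 : gen g a u) (h3 : gen g v b) :
    ∃ a' < 13, ∃ b' < 13, 8 ≤ a' ∧ a' ≠ b' ∧ gen h a' b' ∧ gen g a' u ∧ gen g v b' := by
  rcases lt_or_ge g 2 with hg | hg
  · have key : 12 ≤ a ∧ 12 ≤ b ∧ ∃ a' < 13, ∃ b' < 13, 9 ≤ a' ∧ 9 ≤ b' ∧ a' ≠ b' ∧ gen h a' b' ∧
        a % 2 = a' % 2 ∧ b % 2 = b' % 2 := by
      obtain rfl | ⟨k, rfl⟩ : h = 2 ∨ ∃ k, h = k + 3 := by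
        rcases hgh with h' | h'
        · omega
        · rcases h'.eq_or_lt with h' | h'
          · exact Or.inl h'.symm
          · exact Or.inr ⟨h - 3, by omega⟩
      · have hc : 12 ≤ a ∧ 12 ≤ b ∧ ((a % 2 = 1 ∧ b = a + 1) ∨ (a % 2 = 0 ∧ b + 1 = a)) := by
          rcases hab with h | h
          · rw [gen_two_iff_of_left (by omega)] at h1; omega
          · rw [gen_two_iff_of_right (by omega)] at h1; omega
        refine ⟨hc.1, hc.2.1, ?_⟩
        rcases hc.2.2 with hc | hc
        · exact ⟨9, by omega, 10, by omega, by omega, by omega, by omega, by decide +kernel,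
            by omega, by omega⟩
        · exact ⟨10, by omega, 9, by omega, by omega, by omega, by omega, by decide +kernel,
            by omega, by omega⟩
      · have hc : 12 ≤ a ∧ 12 ≤ b ∧ ((a % 2 = 0 ∧ b = a + 1) ∨ (a % 2 = 1 ∧ b + 1 = a)) := by
          rcases hab with h | h
          · rw [gen_three_iff_of_left (by omega)] at h1; omega
          · rw [gen_three_iff_of_right (by omega)] at h1; omega
        refine ⟨hc.1, hc.2.1, ?_⟩
        rcases hc.2.2 with hc | hc
        · exact ⟨10, by omega, 11, by omega, by omega, by omega, by omega,
            (gen_three_iff_of_left (by omega)).2 (by omega), by omega, by omega⟩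
        · exact ⟨11, by omega, 10, by omega, by omega, by omega, by omega,
            (gen_three_iff_of_left (by omega)).2 (by omega), by omega, by omega⟩
    obtain ⟨ha, hb, a', ha', b', hb', ha9, hb9, hne', hgen, hpa, hpb⟩ := key
    exact ⟨a', ha', b', hb', by omega, hne', hgen,
      gen_left_of_parity (by omega) ha9 hpa hu h2, gen_right_of_parity (by omega) hb9 hpb hv h3⟩
  · exfalso
    obtain rfl | ⟨k, rfl⟩ : g = 2 ∨ ∃ k, g = k + 3 := by
      rcases hg.eq_or_lt with h' | h'
      · exact Or.inl h'.symm
      · exact Or.inr ⟨g - 3, by omega⟩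
    · rcases hab with h | h
      · rw [gen_two_iff_of_left (by omega)] at h2; omega
      · rw [gen_two_iff_of_right (by omega)] at h3; omega
    · rcases hab with h | h
      · rw [gen_three_iff_of_left (by omega)] at h2; omega
      · rw [gen_three_iff_of_right (by omega)] at h3; omega

/-- A derivation step for atoms: `cut u v s t g h` obtains the atom `(s, t)` as the meet of `gen h`
with the join of `gen g` and the atom `(u, v)`, `via a k b h` obtains `(a, b)` as the meet of
`gen h` with the join of `(a, k)` and `(k, b)`, and `fork a b k l` obtains `(a, b)` from the two
paths through `k` and `l`. -/
inductive Step
  | cut (u v s t g h : ℕ)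
  | via (a k b h : ℕ)
  | fork (a b k l : ℕ)

/-- The atom obtained by a step. -/
def Step.target : Step → ℕ × ℕ
  | cut _ _ s t _ _ => (s, t)
  | via a _ b _ => (a, b)
  | fork a b _ _ => (a, b)

/-- The relations among the elements below `13` that make a cut step correct. -/
def CutCondition (u v s t g h : ℕ) : Prop :=
  gen h s t ∧ gen g s u ∧ gen g v t ∧ ∀ a < 13, ∀ b < 13, gen h a b →
    (gen g a b ∨ (gen g a u ∧ gen g v b)) → a = b ∨ (a = s ∧ b = t)

/-- A step is valid if it uses known atoms and its side conditions hold. -/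
def Step.Valid (K : List (ℕ × ℕ)) : Step → Prop
  | cut u v s t g h => (u, v) ∈ K ∧ u < 8 ∧ v < 8 ∧ s < 8 ∧ g < 4 ∧ h < 4 ∧ g ≠ h ∧
      (2 ≤ g ∨ 2 ≤ h) ∧ CutCondition u v s t g h
  | via a k b h => (a, k) ∈ K ∧ (k, b) ∈ K ∧ k < 8 ∧ h < 4 ∧ a ≠ b ∧
      gen h a b ∧ ¬ gen h a k ∧ ¬ gen h k b
  | fork a b k l => (a, k) ∈ K ∧ (k, b) ∈ K ∧ (a, l) ∈ K ∧ (l, b) ∈ K ∧ k < 8 ∧ l < 8 ∧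
      a ≠ b ∧ k ≠ l ∧ a ≠ k ∧ k ≠ b

set_option synthInstance.maxSize 1000 in
instance (u v s t g h : ℕ) : Decidable (CutCondition u v s t g h) :=
  inferInstanceAs (Decidable (_ ∧ _))

instance (K : List (ℕ × ℕ)) (s : Step) : Decidable (s.Valid K) :=
  match s with
  | .cut .. => inferInstanceAs (Decidable (_ ∧ _))
  | .via .. => inferInstanceAs (Decidable (_ ∧ _))
  | .fork .. => inferInstanceAs (Decidable (_ ∧ _))

/-- The atoms derived from `K` by the valid steps in a list. -/
def derive (K : List (ℕ × ℕ)) : List Step → List (ℕ × ℕ)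
  | [] => K
  | s :: l => derive (if s.Valid K then s.target :: K else K) l

/-- A derivation of all atoms among the elements below `8`. -/
def baseSteps : List Step :=
  [.cut 4 3 0 3 2 0, .cut 0 3 6 5 2 3, .cut 0 3 0 4 3 2, .cut 6 5 6 2 0 2,
   .cut 6 5 2 5 2 1, .cut 0 4 7 6 0 3, .cut 6 2 4 1 0 3, .cut 6 2 5 2 3 0,
   .cut 2 5 2 6 3 2, .cut 7 6 7 0 2 0, .cut 4 1 2 1 2 0, .cut 2 6 5 6 0 3,
   .cut 7 0 6 0 3 2, .cut 2 1 2 4 3 2, .fork 6 4 0 2, .fork 5 4 2 6,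
   .cut 5 4 3 4 2 3, .via 5 4 1 0, .cut 5 1 3 1 2 3, .fork 0 1 3 4,
   .fork 6 1 0 2, .fork 6 3 0 4, .fork 2 3 4 6, .cut 2 3 1 3 0 3,
   .cut 1 3 1 5 2 1, .cut 1 5 4 6 3 0, .cut 1 5 3 5 3 2, .fork 0 5 1 3,
   .cut 0 5 7 5 0 3, .cut 0 5 0 7 3 0, .cut 0 7 6 7 2 3, .fork 0 6 4 5,
   .fork 0 2 5 6, .via 1 5 4 3, .fork 1 6 4 5, .cut 1 6 1 2 2 0,
   .fork 3 2 1 5, .cut 3 2 3 0 2 1, .fork 1 0 3 6, .cut 1 0 2 0 0 2,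
   .fork 1 7 0 6, .fork 2 7 0 1, .fork 3 6 0 1, .via 3 1 7 1,
   .via 4 1 0 1, .fork 4 2 0 1, .fork 4 5 0 1, .via 4 1 7 1,
   .fork 5 0 1 2, .cut 5 0 5 7 0 3, .fork 5 3 0 1, .fork 7 1 0 5,
   .fork 7 2 0 1, .via 7 1 3 0, .fork 7 4 0 1]

set_option synthInstance.maxSize 1000 in
theorem mem_derive_baseSteps : ∀ i < 8, ∀ j < 8, i ≠ j → (i, j) ∈ derive [(4, 3)] baseSteps := by
  decide +kernel

/-- An identification of `α` with an initial segment of `ℕ` that contains all numbers below `13`. -/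
structure Indexing {α : Type u} (f : α → ℕ) : Prop where
  injective : Function.Injective f
  exists_of_lt : ∀ n < 13, ∃ a, f a = n
  exists_of_le : ∀ a, ∀ n ≤ f a, ∃ b, f b = n

theorem exists_indexing {α : Type u} (h13 : 13 ≤ Cardinal.mk α)
    (hle : Cardinal.mk α ≤ Cardinal.aleph0) : ∃ f : α → ℕ, Indexing f := by
  have : Countable α := Cardinal.mk_le_aleph0_iff.1 hle
  rcases finite_or_infinite α with hfin | hinf
  · obtain ⟨n, ⟨e⟩⟩ := Finite.exists_equiv_fin α
    have hn : 13 ≤ n := by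
      rw [Cardinal.mk_congr (e.trans Equiv.ulift.{u}.symm), Cardinal.mk_fintype] at h13
      simpa using h13
    have hsurj : ∀ m < n, ∃ a, (e a : ℕ) = m := fun m hm => ⟨e.symm ⟨m, hm⟩, by simp⟩
    exact ⟨fun a => e a, fun a b h => e.injective (Fin.ext h), fun m hm => hsurj m (by omega),
      fun a m hm => hsurj m (by have := (e a).2; omega)⟩
  · obtain ⟨e⟩ : Nonempty (α ≃ ℕ) := by
      obtain ⟨_⟩ := nonempty_denumerable α
      exact ⟨Denumerable.eqv α⟩
    exact ⟨e, e.injective, fun n _ => e.surjective n, fun _ n _ => e.surjective n⟩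

/-- The `i`-th generator as a relation on `α`. -/
def genRel {α : Type u} (f : α → ℕ) (i : ℕ) : Set (α × α) := {p | gen i (f p.1) (f p.2)}

theorem genRel_isQuoRel {α : Type u} (f : α → ℕ) (i : ℕ) : IsQuoRel (genRel f i) :=
  ⟨fun _ => gen_refl _ _, fun _ _ _ => gen_trans⟩

/-- The pair `(i, j)` of indices yields an atom in `T`. -/
def AtomMem {α : Type u} (f : α → ℕ) (T : Set (Set (α × α))) (i j : ℕ) : Prop :=
  ∀ a b, f a = i → f b = j → singleRel a b ∈ T

namespace Indexing

variable {α : Type u} {f : α → ℕ} {T : Set (Set (α × α))}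

theorem atomMem_of_cut (hf : Indexing f) (hT : QuoSublattice T) {u v s t g h : ℕ}
    (hg : genRel f g ∈ T) (hh : genRel f h ∈ T) (huv : AtomMem f T u v)
    (hu : ∃ a, f a = u) (hv : ∃ a, f a = v)
    (hst : gen h s t) (hsu : gen g s u) (hvt : gen g v t)
    (hcut : ∀ a b, gen h a b → (gen g a b ∨ (gen g a u ∧ gen g v b)) →
      a = b ∨ (a = s ∧ b = t)) : AtomMem f T s t := by
  obtain ⟨x, rfl⟩ := hu
  obtain ⟨y, rfl⟩ := hv
  rintro a b rfl rfl
  refine hT.singleRel_mem_of_cut (huv x y rfl rfl) hg hh hst hsu hvt fun c d hcd hor => ?_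
  rcases hcut _ _ hcd hor with h' | ⟨h', h''⟩
  · exact Or.inl (hf.injective h')
  · exact Or.inr ⟨hf.injective h', hf.injective h''⟩

theorem atomMem_of_cutCondition (hf : Indexing f) (hT : QuoSublattice T)
    (hgen : ∀ i < 4, genRel f i ∈ T) {u v s t g h : ℕ} (hu : u < 8) (hv : v < 8) (hs : s < 8)
    (hg : g < 4) (hh : h < 4) (hne : g ≠ h) (hgh : 2 ≤ g ∨ 2 ≤ h) (huv : AtomMem f T u v)
    (hc : CutCondition u v s t g h) : AtomMem f T s t := by
  obtain ⟨h1, h2, h3, h4⟩ := hc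
  refine hf.atomMem_of_cut hT (hgen g hg) (hgen h hh) huv (hf.exists_of_lt u (by omega))
    (hf.exists_of_lt v (by omega)) h1 h2 h3 fun a b hab hor => ?_
  by_cases hsmall : a < 13 ∧ b < 13
  · exact h4 a hsmall.1 b hsmall.2 hab hor
  left
  rcases hor with hor | ⟨hau, hvb⟩
  · rcases lt_or_gt_of_ne hne with hlt | hlt
    · exact eq_of_gen_of_gen (by omega) hlt hh (by omega) hab hor
    · exact eq_of_gen_of_gen (by omega) hlt hg (by omega) hor hab
  · by_contra hab'
    obtain ⟨a', ha', b', hb', ha8, hne', h5, h6, h7⟩ :=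
      exists_small_of_gen hgh (by omega) hab' hu hv hab hau hvb
    rcases h4 a' ha' b' hb' h5 (Or.inr ⟨h6, h7⟩) with h8 | h8 <;> omega

theorem atomMem_of_valid (hf : Indexing f) (hT : QuoSublattice T)
    (hgen : ∀ i < 4, genRel f i ∈ T) {K : List (ℕ × ℕ)} (hK : ∀ p ∈ K, AtomMem f T p.1 p.2)
    {s : Step} (hs : s.Valid K) : AtomMem f T s.target.1 s.target.2 := by
  match s with
  | .cut u v s t g h =>
    obtain ⟨huv, hu, hv, hs, hg, hh, hne, hgh, hc⟩ := hs
    exact hf.atomMem_of_cutCondition hT hgen hu hv hs hg hh hne hgh (hK _ huv) hc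
  | .via a k b h =>
    obtain ⟨hak, hkb, hk, hh, hab, h1, h2, h3⟩ := hs
    obtain ⟨z, rfl⟩ := hf.exists_of_lt k (by omega)
    rintro x y rfl rfl
    exact hT.singleRel_mem_of_via (ne_of_apply_ne f hab) (hK _ hak x z rfl rfl)
      (hK _ hkb z y rfl rfl) (hgen h hh) h1 h2 h3
  | .fork a b k l =>
    obtain ⟨hak, hkb, hal, hlb, hk, hl, hab, hkl, hak', hkb'⟩ := hs
    obtain ⟨z, rfl⟩ := hf.exists_of_lt k (by omega)
    obtain ⟨w, rfl⟩ := hf.exists_of_lt l (by omega)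
    rintro x y rfl rfl
    exact hT.singleRel_mem_of_fork (ne_of_apply_ne f hab) (ne_of_apply_ne f hkl)
      (ne_of_apply_ne f hak') (ne_of_apply_ne f hkb') (hK _ hak x z rfl rfl)
      (hK _ hkb z y rfl rfl) (hK _ hal x w rfl rfl) (hK _ hlb w y rfl rfl)

theorem atomMem_of_mem_derive (hf : Indexing f) (hT : QuoSublattice T)
    (hgen : ∀ i < 4, genRel f i ∈ T) (l : List Step) {K : List (ℕ × ℕ)}
    (hK : ∀ p ∈ K, AtomMem f T p.1 p.2) : ∀ p ∈ derive K l, AtomMem f T p.1 p.2 := by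
  induction l generalizing K with
  | nil => exact hK
  | cons s l ih =>
    refine ih ?_
    split_ifs with hs
    · intro p hp
      rcases List.mem_cons.1 hp with rfl | hp
      · exact hf.atomMem_of_valid hT hgen hK hs
      · exact hK p hp
    · exact hK

set_option synthInstance.maxSize 1000 in
theorem atomMem_four_three (hf : Indexing f) (hT : QuoSublattice T)
    (hgen : ∀ i < 4, genRel f i ∈ T) : AtomMem f T 4 3 := by
  have hmem := hT.meet _ (hgen 3 (by omega)) _ (hgen 1 (by omega))
  rintro a b ha hb
  convert hmem using 1
  have hab : gen 3 4 3 ∧ gen 1 4 3 := by decide +kernel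
  have hsmall : ∀ i < 13, ∀ j < 13, gen 3 i j → gen 1 i j → i = j ∨ (i = 4 ∧ j = 3) := by
    decide +kernel
  ext ⟨c, d⟩
  constructor
  · rintro (h | h)
    · obtain rfl : c = d := h
      exact ⟨gen_refl _ _, gen_refl _ _⟩
    · obtain ⟨rfl, rfl⟩ := Prod.mk.inj h
      change gen 3 (f c) (f d) ∧ gen 1 (f c) (f d)
      rwa [ha, hb]
  · rintro ⟨h3, h1⟩
    change gen 3 (f c) (f d) at h3
    change gen 1 (f c) (f d) at h1
    have hlarge : 10 ≤ f c ∨ 10 ≤ f d → f c = f d := fun h =>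
      eq_of_gen_of_gen (by omega) (by omega) (by omega) h h3 h1
    rcases lt_or_ge (f c) 13 with hc | hc
    · rcases lt_or_ge (f d) 13 with hd | hd
      · rcases hsmall _ hc _ hd h3 h1 with h | ⟨h, h'⟩
        · exact Or.inl (hf.injective h)
        · exact Or.inr (Prod.ext (hf.injective (h.trans ha.symm)) (hf.injective (h'.trans hb.symm)))
      · exact Or.inl (hf.injective (hlarge (by omega)))
    · exact Or.inl (hf.injective (hlarge (by omega)))

/-- The generators used to attach the element `n + 1` to the elements up to `n`: there is an element
`w < 2` such that joining the atom between `w` and `n` with one generator and meeting with the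
other replaces `n` by `n + 1`. -/
theorem exists_attaching (n : ℕ) (hn : 7 ≤ n) : ∃ w g h, w < 2 ∧ g < 4 ∧ h < 4 ∧
    gen g n (n + 1) ∧ gen g (n + 1) n ∧ gen h w (n + 1) ∧ gen h (n + 1) w ∧
    ¬ gen h w n ∧ ¬ gen h n w ∧
    (∀ a, gen g a w ∨ gen g w a → a = w) ∧
    (∀ a, gen g a n ∨ gen g n a → a = n ∨ a = n + 1) ∧
    (∀ a b, gen g a b → gen h a b → a = b) := by
  rcases Nat.even_or_odd' n with ⟨k, rfl | rfl⟩
  · have hbase : ∀ p ∈ baseTable 3, p.1 ≠ 0 ∧ p.2 ≠ 0 ∧ p.1 < 8 ∧ p.2 < 8 := by decide +kernel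
    have hsmall : ∀ a < 10, ∀ b < 10, gen 3 a b → gen 0 a b → a = b := by decide +kernel
    have h0 : rep 3 0 = 0 ∧ rep 0 0 = 0 ∧ rep 3 (2 * k) = 2 * k ∧ rep 0 (2 * k) = 2 * k ∧
        rep 3 (2 * k + 1) = 2 * k ∧ rep 0 (2 * k + 1) = 0 := by
      simp only [rep]
      split_ifs <;> omega
    obtain ⟨e1, e2, e3, e4, e5, e6⟩ := h0
    refine ⟨0, 3, 0, by omega, by omega, by omega, Or.inl (e3.trans e5.symm),
      Or.inl (e5.trans e3.symm), Or.inl (e2.trans e6.symm), Or.inl (e6.trans e2.symm), ?_, ?_,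
      ?_, ?_, ?_⟩
    · rw [gen_iff_of_le_right (by omega)]; omega
    · rw [gen_iff_of_le_left (by omega)]; omega
    · rintro a ((h | h) | (h | h))
      · simp only [rep] at h; split_ifs at h <;> omega
      · exact absurd e1 (hbase _ h).2.1
      · simp only [rep] at h; split_ifs at h <;> omega
      · exact absurd e1 (hbase _ h).1
    · intro a h
      rw [gen_iff_of_le_right (by omega), gen_iff_of_le_left (by omega)] at h
      simp only [rep] at h; split_ifs at h <;> omega
    · intro a b h h'
      by_cases hab : a < 10 ∧ b < 10
      · exact hsmall a hab.1 b hab.2 h h'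
      · exact eq_of_gen_of_gen (by omega) (by omega) (by omega) (by omega) h h'
  · have hbase : ∀ p ∈ baseTable 2, p.1 ≠ 1 ∧ p.2 ≠ 1 ∧ p.1 < 7 ∧ p.2 < 7 := by decide +kernel
    have hsmall : ∀ a < 10, ∀ b < 10, gen 2 a b → gen 1 a b → a = b := by decide +kernel
    have hnot : ∀ j, j = 0 ∨ j = 7 → (1, j) ∉ baseTable 1 ∧ (j, 1) ∉ baseTable 1 := by
      rintro j (rfl | rfl) <;> decide +kernel
    have h0 : rep 2 1 = 1 ∧ rep 1 1 = 1 ∧ rep 2 (2 * k + 1) = 2 * k + 1 ∧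
        (rep 1 (2 * k + 1) = 0 ∨ rep 1 (2 * k + 1) = 7) ∧
        rep 2 (2 * k + 1 + 1) = 2 * k + 1 ∧ rep 1 (2 * k + 1 + 1) = 1 := by
      simp only [rep]
      split_ifs <;> omega
    obtain ⟨e1, e2, e3, e4, e5, e6⟩ := h0
    refine ⟨1, 2, 1, by omega, by omega, by omega, Or.inl (e3.trans e5.symm),
      Or.inl (e5.trans e3.symm), Or.inl (e2.trans e6.symm), Or.inl (e6.trans e2.symm), ?_, ?_,
      ?_, ?_, ?_⟩
    · rintro (h | h)
      · omega
      · exact (hnot _ e4).1 (e2 ▸ h)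
    · rintro (h | h)
      · omega
      · exact (hnot _ e4).2 (e2 ▸ h)
    · rintro a ((h | h) | (h | h))
      · simp only [rep] at h; split_ifs at h <;> omega
      · exact absurd e1 (hbase _ h).2.1
      · simp only [rep] at h; split_ifs at h <;> omega
      · exact absurd e1 (hbase _ h).1
    · rintro a ((h | h) | (h | h))
      · simp only [rep] at h; split_ifs at h <;> omega
      · have := (hbase _ h).2.2.2; omega
      · simp only [rep] at h; split_ifs at h <;> omega
      · have := (hbase _ h).2.2.1; omega
    · intro a b h h'
      by_cases hab : a < 10 ∧ b < 10
      · exact hsmall a hab.1 b hab.2 h h'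
      · exact eq_of_gen_of_gen (by omega) (by omega) (by omega) (by omega) h h'

theorem atomMem_of_le (hf : Indexing f) (hT : QuoSublattice T)
    (hgen : ∀ i < 4, genRel f i ∈ T) (n : ℕ) (hn : 7 ≤ n) :
    ∀ i ≤ n, ∀ j ≤ n, i ≠ j → AtomMem f T i j := by
  induction n, hn using Nat.le_induction with
  | base =>
    intro i hi j hj hij
    refine hf.atomMem_of_mem_derive hT hgen baseSteps ?_ (i, j)
      (mem_derive_baseSteps i (by omega) j (by omega) hij)
    intro p hp
    rw [List.mem_singleton.1 hp]
    exact hf.atomMem_four_three hT hgen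
  | succ n hn ih =>
    by_cases hex : ∃ a, f a = n + 1
    swap
    · intro i hi j hj hij x y hx hy
      exact ih i (by by_contra; exact hex ⟨x, by omega⟩) j (by by_contra; exact hex ⟨y, by omega⟩)
        hij x y hx hy
    obtain ⟨z, hz⟩ := hex
    have hpre : ∀ m ≤ n, ∃ a, f a = m := fun m hm => hf.exists_of_le z m (by omega)
    obtain ⟨w, g, h, hw, hg, hh, hg1, hg2, hh1, hh2, hwn, hnw, hgw, hgn, hgh⟩ :=
      exists_attaching n hn
    obtain ⟨x, rfl⟩ := hpre w (by omega)
    obtain ⟨y, rfl⟩ := hpre n le_rfl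
    have hxy : f x ≠ f y := by omega
    have hxz : AtomMem f T (f x) (f y + 1) := by
      refine hf.atomMem_of_cut hT (hgen g hg) (hgen h hh) (ih _ (by omega) _ le_rfl hxy)
        ⟨x, rfl⟩ ⟨y, rfl⟩ hh1 (gen_refl _ _) hg1 fun a b hab hor => ?_
      rcases hor with hor | ⟨h1, h2⟩
      · exact Or.inl (hgh a b hor hab)
      · obtain rfl := hgw a (Or.inl h1)
        rcases hgn b (Or.inr h2) with rfl | rfl
        · exact absurd hab hwn
        · exact Or.inr ⟨rfl, rfl⟩
    have hzx : AtomMem f T (f y + 1) (f x) := by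
      refine hf.atomMem_of_cut hT (hgen g hg) (hgen h hh) (ih _ le_rfl _ (by omega) hxy.symm)
        ⟨y, rfl⟩ ⟨x, rfl⟩ hh2 hg2 (gen_refl _ _) fun a b hab hor => ?_
      rcases hor with hor | ⟨h1, h2⟩
      · exact Or.inl (hgh a b hor hab)
      · obtain rfl := hgw b (Or.inr h2)
        rcases hgn a (Or.inl h1) with rfl | rfl
        · exact absurd hab hnw
        · exact Or.inr ⟨rfl, rfl⟩
    have hgyx : ¬ gen g (f y) (f x) := fun h' => hxy (hgw _ (Or.inl h')).symm
    have hgxy : ¬ gen g (f x) (f y) := fun h' => hxy (hgw _ (Or.inr h')).symm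
    have hgxz : ¬ gen g (f x) (f z) := fun h' => by
      have := hgw _ (Or.inr h'); omega
    have hgzx : ¬ gen g (f z) (f x) := fun h' => by
      have := hgw _ (Or.inl h'); omega
    have hne : ∀ {a b : α}, f a ≠ f b → a ≠ b := fun h' => ne_of_apply_ne f h'
    rw [← hz] at hg1 hg2 hxz hzx
    have hsxz := hxz x z rfl rfl
    have hszx := hzx z x rfl rfl
    have hsyx := ih (f y) le_rfl (f x) (by omega) hxy.symm y x rfl rfl
    have hsxy := ih (f x) (by omega) (f y) le_rfl hxy x y rfl rfl
    have hsyz : singleRel y z ∈ T := hT.singleRel_mem_of_via (hne (by omega)) hsyx hsxz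
      (hgen g hg) hg1 hgyx hgxz
    have hszy : singleRel z y ∈ T := hT.singleRel_mem_of_via (hne (by omega)) hszx hsxy
      (hgen g hg) hg2 hgzx hgxy
    have hto : ∀ a, f a ≤ f y → singleRel a z ∈ T := fun a ha => by
      by_cases hax : a = x
      · rwa [hax]
      by_cases hay : a = y
      · rwa [hay]
      exact hT.singleRel_mem_of_fork (k := x) (l := y) (hne (by omega)) (hne (by omega)) hax
        (hne (by omega)) (ih _ ha _ (by omega) (hf.injective.ne hax) a x rfl rfl) hsxz
        (ih _ ha _ le_rfl (hf.injective.ne hay) a y rfl rfl) hsyz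
    have hfrom : ∀ a, f a ≤ f y → singleRel z a ∈ T := fun a ha => by
      by_cases hax : a = x
      · rwa [hax]
      by_cases hay : a = y
      · rwa [hay]
      exact hT.singleRel_mem_of_fork (k := x) (l := y) (hne (by omega)) (hne (by omega))
        (hne (by omega)) (Ne.symm hax) hszx
        (ih _ (by omega) _ ha (hf.injective.ne (Ne.symm hax)) x a rfl rfl) hszy
        (ih _ le_rfl _ ha (hf.injective.ne (Ne.symm hay)) y a rfl rfl)
    rintro i hi j hj hij a b rfl rfl
    rcases hi.lt_or_eq with hi | hi
    · rcases hj.lt_or_eq with hj | hj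
      · exact ih _ (by omega) _ (by omega) hij a b rfl rfl
      · obtain rfl : b = z := hf.injective (by omega)
        exact hto a (by omega)
    · obtain rfl : a = z := hf.injective (by omega)
      exact hfrom b (by omega)

end Indexing

/-- If `13 ≤ |A| ≤ ℵ₀` and either `|A|` is an odd natural number or `|A|` is even
(`ℵ₀` regarded as even) with `|A| ≥ 58`, then `Quo(A)` has a sublattice (closed under
binary joins and binary meets only) that contains all atoms of `Quo(A)` and is generated
by a four-element set `{x₁,x₂,x₃,x₄}` with `x₁ < x₂` such that `{x₁,x₃,x₄}` and
`{x₂,x₃,x₄}` are antichains. -/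
theorem quo_sublattice_with_atoms {α : Type u} (h13 : 13 ≤ Cardinal.mk α)
    (hle : Cardinal.mk α ≤ Cardinal.aleph0)
    (hpar : (∃ n : ℕ, Cardinal.mk α = n ∧ Odd n) ∨
      (((∃ n : ℕ, Cardinal.mk α = n ∧ Even n) ∨ Cardinal.mk α = Cardinal.aleph0) ∧
        58 ≤ Cardinal.mk α)) :
    ∃ x₁ x₂ x₃ x₄ : Set (α × α),
      IsQuoRel x₁ ∧ IsQuoRel x₂ ∧ IsQuoRel x₃ ∧ IsQuoRel x₄ ∧
      x₁ ⊂ x₂ ∧ Incomp x₁ x₃ ∧ Incomp x₁ x₄ ∧ Incomp x₂ x₃ ∧ Incomp x₂ x₄ ∧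
      Incomp x₃ x₄ ∧
      ∀ T ⊆ QuoRels α, ({x₁, x₂, x₃, x₄} : Set (Set (α × α))) ⊆ T →
        (∀ a ∈ T, ∀ b ∈ T, quoGen (a ∪ b) ∈ T) →
        (∀ a ∈ T, ∀ b ∈ T, a ∩ b ∈ T) →
        ∀ r : Set (α × α), QuoAtom r → r ∈ T := by
  obtain ⟨f, hf⟩ := exists_indexing h13 hle
  have not_genRel_subset : ∀ i j a b, a < 13 ∧ b < 13 ∧ gen i a b ∧ ¬ gen j a b →
      ¬ genRel f i ⊆ genRel f j := by
    rintro i j a b ⟨ha, hb, hi, hj⟩ hsub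
    obtain ⟨x, rfl⟩ := hf.exists_of_lt a ha
    obtain ⟨y, rfl⟩ := hf.exists_of_lt b hb
    exact hj (hsub (show (x, y) ∈ genRel f i from hi))
  refine ⟨genRel f 0, genRel f 1, genRel f 2, genRel f 3, genRel_isQuoRel f 0,
    genRel_isQuoRel f 1, genRel_isQuoRel f 2, genRel_isQuoRel f 3,
    ⟨fun _ => gen_one_of_gen_zero,
      not_genRel_subset 1 0 1 5 (by decide +kernel)⟩,
    ⟨not_genRel_subset 0 2 0 3 (by decide +kernel),
      not_genRel_subset 2 0 0 4 (by decide +kernel)⟩,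
    ⟨not_genRel_subset 0 3 0 3 (by decide +kernel),
      not_genRel_subset 3 0 1 3 (by decide +kernel)⟩,
    ⟨not_genRel_subset 1 2 0 3 (by decide +kernel),
      not_genRel_subset 2 1 0 4 (by decide +kernel)⟩,
    ⟨not_genRel_subset 1 3 0 3 (by decide +kernel),
      not_genRel_subset 3 1 1 3 (by decide +kernel)⟩,
    ⟨not_genRel_subset 2 3 0 4 (by decide +kernel),
      not_genRel_subset 3 2 1 3 (by decide +kernel)⟩, ?_⟩
  intro T hTQ hT hjoin hmeet r hr
  obtain ⟨a, b, hab, rfl⟩ := hr.exists_eq_singleRel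
  have hgen : ∀ i < 4, genRel f i ∈ T := by
    intro i hi
    apply hT
    interval_cases i <;> simp
  exact hf.atomMem_of_le ⟨hTQ, hjoin, hmeet⟩ hgen (max 7 (max (f a) (f b))) (by omega) _
    (by omega) _ (by omega) (hf.injective.ne hab) a b rfl rfl
end

section
/- Let A be a set with |A| ≥ 3 and let S be a complete sublattice of Quo(A), i.e., a subset of Quo(A) closed under arbitrary joins and arbitrary meets of Quo(A). If S properly contains Equ(A) (that is, Equ(A) ⊆ S and Equ(A) ≠ S), then S = Quo(A). -/
universe u

open Set

/-- The diagonal together with the single pair `(a, b)`. -/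
def diagPair {α : Type u} (a b : α) : Set (α × α) := {p | p.1 = p.2 ∨ p = (a, b)}

/-- The equivalence relation whose only nontrivial block is `{a, b}`. -/
def blockPair {α : Type u} (a b : α) : Set (α × α) :=
  {p | p.1 = p.2 ∨ (p.1 = a ∨ p.1 = b) ∧ (p.2 = a ∨ p.2 = b)}

theorem blockPair_mem_EquRels {α : Type u} (a b : α) : blockPair a b ∈ EquRels α := by
  refine ⟨⟨fun x => Or.inl rfl, fun x y z hxy hyz => ?_⟩, fun p hp => ?_⟩
  · simp only [blockPair, mem_ofPred_eq] at *
    grind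
  · simp only [blockPair, mem_ofPred_eq] at *
    grind

theorem quoGen_isQuoRel {α : Type u} (r : Set (α × α)) : IsQuoRel (quoGen r) :=
  ⟨fun a _ hs => hs.1.1 a,
    fun a b c hab hbc s hs => hs.1.2 a b c (hab s hs) (hbc s hs)⟩

theorem subset_quoGen {α : Type u} (r : Set (α × α)) : r ⊆ quoGen r :=
  fun _ hp _ hs => hs.2 hp

theorem quoGen_subset {α : Type u} {r s : Set (α × α)} (hs : IsQuoRel s) (h : r ⊆ s) :
    quoGen r ⊆ s :=
  fun _ hp => hp s ⟨hs, h⟩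

theorem QuoClosed.inter_mem {α : Type u} {S : Set (Set (α × α))} (hS : QuoClosed S)
    {r s : Set (α × α)} (hr : r ∈ S) (hs : s ∈ S) : r ∩ s ∈ S := by
  rw [← sInter_pair]
  exact hS.2 _ (pair_subset hr hs)

theorem QuoClosed.quoGen_union_mem {α : Type u} {S : Set (Set (α × α))} (hS : QuoClosed S)
    {r s : Set (α × α)} (hr : r ∈ S) (hs : s ∈ S) : quoGen (r ∪ s) ∈ S := by
  rw [← sUnion_pair]
  exact hS.1 _ (pair_subset hr hs)

/-- Meeting with a block `{a, b}` isolates the pair `(a, b)`. -/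
theorem inter_blockPair {α : Type u} {r : Set (α × α)} (hr : IsQuoRel r) {a b : α}
    (hab : (a, b) ∈ r) (hba : (b, a) ∉ r) : r ∩ blockPair a b = diagPair a b := by
  ext ⟨x, y⟩
  simp only [blockPair, diagPair, mem_inter_iff, mem_ofPred_eq, Prod.mk.injEq]
  constructor
  · rintro ⟨hxy, h | ⟨rfl | rfl, rfl | rfl⟩⟩ <;> simp_all
  · rintro (rfl | ⟨rfl, rfl⟩)
    · exact ⟨hr.1 x, Or.inl rfl⟩
    · exact ⟨hab, by simp⟩

theorem diagPair_mem_of_right {α : Type u} {S : Set (Set (α × α))} (hS : QuoClosed S)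
    (hsub : EquRels α ⊆ S) {a b c : α} (hab : a ≠ b) (hac : a ≠ c) (h : diagPair a b ∈ S) :
    diagPair a c ∈ S := by
  have hq := quoGen_isQuoRel (diagPair a b ∪ blockPair b c)
  rw [← inter_blockPair hq]
  · exact hS.inter_mem (hS.quoGen_union_mem h (hsub (blockPair_mem_EquRels b c)))
      (hsub (blockPair_mem_EquRels a c))
  · exact hq.2 a b c (subset_quoGen _ (Or.inl (Or.inr rfl)))
      (subset_quoGen _ (Or.inr (by simp [blockPair])))
  · intro hca
    have hle : quoGen (diagPair a b ∪ blockPair b c) ⊆ {p | p.2 = a → p.1 = a} := by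
      refine quoGen_subset ⟨fun _ => id, fun x y z hxy hyz (hz : z = a) => hxy (hyz hz)⟩ ?_
      rintro ⟨x, y⟩ hp
      simp only [diagPair, blockPair, mem_union, mem_ofPred_eq, Prod.mk.injEq] at *
      grind
    exact hac (hle hca rfl).symm

theorem diagPair_mem_of_left {α : Type u} {S : Set (Set (α × α))} (hS : QuoClosed S)
    (hsub : EquRels α ⊆ S) {a b c : α} (hab : a ≠ b) (hcb : c ≠ b) (h : diagPair a b ∈ S) :
    diagPair c b ∈ S := by
  have hq := quoGen_isQuoRel (diagPair a b ∪ blockPair c a)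
  rw [← inter_blockPair hq]
  · exact hS.inter_mem (hS.quoGen_union_mem h (hsub (blockPair_mem_EquRels c a)))
      (hsub (blockPair_mem_EquRels c b))
  · exact hq.2 c a b (subset_quoGen _ (Or.inr (by simp [blockPair])))
      (subset_quoGen _ (Or.inl (Or.inr rfl)))
  · intro hbc
    have hle : quoGen (diagPair a b ∪ blockPair c a) ⊆ {p | p.1 = b → p.2 = b} := by
      refine quoGen_subset ⟨fun _ => id, fun x y z hxy hyz (hx : x = b) => hyz (hxy hx)⟩ ?_
      rintro ⟨x, y⟩ hp
      simp only [diagPair, blockPair, mem_union, mem_ofPred_eq, Prod.mk.injEq] at *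
      grind
    exact hcb (hle hbc rfl)

theorem diagPair_mem_of_mem {α : Type u} (h3 : 3 ≤ Cardinal.mk α) {S : Set (Set (α × α))}
    (hS : QuoClosed S) (hsub : EquRels α ⊆ S) {a b : α} (hab : a ≠ b)
    (h : diagPair a b ∈ S) {x y : α} (hxy : x ≠ y) : diagPair x y ∈ S := by
  have avoiding_left {y : α} (hay : a ≠ y) {x : α} (hxy : x ≠ y) : diagPair x y ∈ S :=
    diagPair_mem_of_left hS hsub hay hxy (diagPair_mem_of_right hS hsub hab hay h)
  obtain ⟨c, hca, hcx⟩ := Cardinal.exists_ne_ne_of_three_le h3 a x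
  by_cases hay : a = y
  · exact diagPair_mem_of_right hS hsub hcx.symm hxy (avoiding_left hca.symm hcx.symm)
  · exact avoiding_left hay hxy

/-- Every quasiorder is the join of the atoms `diagPair a b` below it. -/
theorem quoGen_sUnion_diagPair {α : Type u} {r : Set (α × α)} (hr : IsQuoRel r) :
    quoGen (⋃₀ {s | ∃ a b, a ≠ b ∧ (a, b) ∈ r ∧ s = diagPair a b}) = r := by
  apply Subset.antisymm
  · apply quoGen_subset hr
    rintro ⟨x, y⟩ ⟨_, ⟨a, b, -, hab, rfl⟩, (rfl : x = y) | h⟩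
    · exact hr.1 x
    · rwa [h]
  · rintro ⟨x, y⟩ hxy
    by_cases h : x = y
    · exact h ▸ (quoGen_isQuoRel _).1 x
    · exact subset_quoGen _ ⟨_, ⟨x, y, h, hxy, rfl⟩, Or.inr rfl⟩

/-- Kulin's lemma: if `|A| ≥ 3` and `S` is a complete sublattice of `Quo(A)` that
properly contains `Equ(A)`, then `S = Quo(A)`. -/
theorem quo_eq_of_equ_ssubset {α : Type u} (h3 : 3 ≤ Cardinal.mk α)
    (S : Set (Set (α × α))) (hS : S ⊆ QuoRels α) (hclosed : QuoClosed S)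
    (hsub : EquRels α ⊆ S) (hne : EquRels α ≠ S) :
    S = QuoRels α := by
  obtain ⟨r, hrS, hr⟩ : ∃ r ∈ S, r ∉ EquRels α := by
    by_contra! h
    exact hne (hsub.antisymm h)
  obtain ⟨a, b, hab, hba⟩ : ∃ a b, (a, b) ∈ r ∧ (b, a) ∉ r := by
    by_contra! h
    exact hr ⟨hS hrS, fun p hp => h p.1 p.2 hp⟩
  have hne' : a ≠ b := by
    rintro rfl
    exact hba hab
  have hmem : diagPair a b ∈ S := by
    rw [← inter_blockPair (hS hrS) hab hba]
    exact hclosed.inter_mem hrS (hsub (blockPair_mem_EquRels a b))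
  refine hS.antisymm fun q hq => ?_
  rw [← quoGen_sUnion_diagPair hq]
  apply hclosed.1
  rintro _ ⟨x, y, hxy, -, rfl⟩
  exact diagPair_mem_of_mem h3 hclosed hsub hne' hmem hxy
end

section
/- Let A be a set, let j, k ≥ 1 be natural numbers, and let {u, v}, {x₁, …, x_{j−1}}, {y₁, …, y_{k−1}} be pairwise disjoint subsets of A with u ≠ v, where x₁, …, x_{j−1} are pairwise distinct and y₁, …, y_{k−1} are pairwise distinct. Set x₀ = y₀ = u and x_j = y_k = v. Then in the complete lattice Equ(A) of equivalence relations on A: equ(u,v) = (⋁_{i=1}^{j} equ(x_{i−1}, x_i)) ∧ (⋁_{i=1}^{k} equ(y_{i−1}, y_i)), where ⋁ denotes join in Equ(A) and ∧ denotes intersection. -/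
universe u

open Set

/-- The relation with at most one nontrivial class, namely `S`, is an equivalence relation. -/
theorem isEquRel_block {α : Type u} (S : Set α) :
    IsEquRel {p : α × α | p.1 = p.2 ∨ (p.1 ∈ S ∧ p.2 ∈ S)} := by
  refine ⟨⟨fun a => Or.inl rfl, ?_⟩, ?_⟩
  · rintro a b c (h | h) (h' | h') <;> simp_all
  · rintro ⟨a, b⟩ (h | h)
    · exact Or.inl h.symm
    · exact Or.inr h.symm

theorem isEquRel_equGen {α : Type u} (r : Set (α × α)) : IsEquRel (equGen r) :=
  ⟨⟨fun a _ hs => hs.1.1.1 a,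
    fun a b c hab hbc s hs => hs.1.1.2 a b c (hab s hs) (hbc s hs)⟩,
    fun p hp s hs => hs.1.2 p (hp s hs)⟩

theorem subset_equGen {α : Type u} (r : Set (α × α)) : r ⊆ equGen r :=
  fun _ hp _ hs => hs.2 hp

theorem equGen_subset {α : Type u} {r s : Set (α × α)} (hs : IsEquRel s) (h : r ⊆ s) :
    equGen r ⊆ s :=
  fun _ hp => hp s ⟨hs, h⟩

theorem mem_equPair {α : Type u} (a b : α) : (a, b) ∈ equPair a b :=
  subset_equGen _ rfl

theorem equPair_subset {α : Type u} {a b : α} {s : Set (α × α)} (hs : IsEquRel s)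
    (h : (a, b) ∈ s) : equPair a b ⊆ s :=
  equGen_subset hs (singleton_subset_iff.2 h)

/-- The endpoints of a path are related by the join of the equivalences of its edges. -/
theorem mem_equGen_path {α : Type u} (x : ℕ → α) (j : ℕ) :
    (x 0, x j) ∈ equGen (⋃ i ∈ Finset.Icc 1 j, equPair (x (i - 1)) (x i)) := by
  have H := isEquRel_equGen (⋃ i ∈ Finset.Icc 1 j, equPair (x (i - 1)) (x i))
  have key : ∀ i ≤ j,
      (x 0, x i) ∈ equGen (⋃ i ∈ Finset.Icc 1 j, equPair (x (i - 1)) (x i)) := by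
    intro i
    induction i with
    | zero => exact fun _ => H.1.1 _
    | succ i ih =>
      intro hi
      refine H.1.2 _ _ _ (ih (by omega)) (subset_equGen _ ?_)
      exact mem_biUnion (x := i + 1) (Finset.mem_coe.2 (Finset.mem_Icc.2 ⟨by omega, hi⟩))
        (mem_equPair _ _)
  exact key j le_rfl

/-- The join of the equivalences of the edges of a path only identifies vertices of the path. -/
theorem equGen_path_subset {α : Type u} (x : ℕ → α) (j : ℕ) :
    equGen (⋃ i ∈ Finset.Icc 1 j, equPair (x (i - 1)) (x i)) ⊆
      {p : α × α | p.1 = p.2 ∨ (p.1 ∈ x '' Iic j ∧ p.2 ∈ x '' Iic j)} := by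
  refine equGen_subset (isEquRel_block _) (iUnion₂_subset fun i hi => ?_)
  have hi' := Finset.mem_Icc.1 hi
  exact equPair_subset (isEquRel_block _)
    (Or.inr ⟨⟨i - 1, mem_Iic.2 (by omega), rfl⟩, ⟨i, mem_Iic.2 hi'.2, rfl⟩⟩)

/-- The circle principle in `Equ(A)`: if `{u,v}`, `{x₁,…,x_{j-1}}`, `{y₁,…,y_{k-1}}`
are pairwise disjoint subsets of `A` (with `u ≠ v` and the `xᵢ`'s, resp. `yᵢ`'s,
pairwise distinct), `x₀ = y₀ = u`, and `x_j = y_k = v`, then `equ(u,v)` is the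
intersection of the join of the `equ(x_{i-1},x_i)` and the join of the
`equ(y_{i-1},y_i)`. -/
theorem circle_principle_equ {α : Type u} (j k : ℕ) (hj : 1 ≤ j) (hk : 1 ≤ k)
    (u v : α) (huv : u ≠ v) (x y : ℕ → α)
    (hx0 : x 0 = u) (hxj : x j = v) (hy0 : y 0 = u) (hyk : y k = v)
    (hxinj : ∀ i i' : ℕ, 0 < i → i < j → 0 < i' → i' < j → x i = x i' → i = i')
    (hyinj : ∀ i i' : ℕ, 0 < i → i < k → 0 < i' → i' < k → y i = y i' → i = i')
    (hxuv : ∀ i : ℕ, 0 < i → i < j → x i ≠ u ∧ x i ≠ v)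
    (hyuv : ∀ i : ℕ, 0 < i → i < k → y i ≠ u ∧ y i ≠ v)
    (hxy : ∀ i i' : ℕ, 0 < i → i < j → 0 < i' → i' < k → x i ≠ y i') :
    equPair u v =
      equGen (⋃ i ∈ Finset.Icc 1 j, equPair (x (i - 1)) (x i)) ∩
        equGen (⋃ i ∈ Finset.Icc 1 k, equPair (y (i - 1)) (y i)) := by
  apply Subset.antisymm
  · refine subset_inter (equPair_subset (isEquRel_equGen _) ?_)
      (equPair_subset (isEquRel_equGen _) ?_)
    · simpa only [hx0, hxj] using mem_equGen_path x j
    · simpa only [hy0, hyk] using mem_equGen_path y k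
  · rintro ⟨a, b⟩ ⟨hx, hy⟩
    have H : IsEquRel (equPair u v) := isEquRel_equGen _
    have common : ∀ c ∈ x '' Iic j, c ∈ y '' Iic k → c = u ∨ c = v := by
      rintro _ ⟨i, hi, rfl⟩ ⟨i', hi', h⟩
      rw [mem_Iic] at hi hi'
      rcases Nat.eq_zero_or_pos i with rfl | hi0
      · exact Or.inl hx0
      rcases hi.eq_or_lt with rfl | hij
      · exact Or.inr hxj
      rcases Nat.eq_zero_or_pos i' with rfl | hi0'
      · exact Or.inl (h.symm.trans hy0)
      rcases hi'.eq_or_lt with rfl | hik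
      · exact Or.inr (h.symm.trans hyk)
      exact absurd h.symm (hxy i i' hi0 hij hi0' hik)
    rcases equGen_path_subset x j hx with h | ⟨hax, hbx⟩
    · obtain rfl : a = b := h
      exact H.1.1 a
    rcases equGen_path_subset y k hy with h | ⟨hay, hby⟩
    · obtain rfl : a = b := h
      exact H.1.1 a
    rcases common a hax hay with rfl | rfl <;> rcases common b hbx hby with rfl | rfl
    · exact H.1.1 _
    · exact mem_equPair _ _
    · exact H.2 _ (mem_equPair _ _)
    · exact H.1.1 _
end
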